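/- arXiv:math/0307192 — 2 statements merged into one kernel-verified Lean document; each statement's English description precedes it below -/
import Mathlib

section
/- Let A be a unital C*-algebra and let p, q be selfadjoint elements of A with p² = q² = 1. Set x := (p − q p q)/2 and y := (p + q p q)/2, so that p = x + y, x is selfadjoint and anticommutes with q, and y is selfadjoint and commutes with q. If ‖x‖ < √3/2 and ‖y − q‖ < 1/2, then y = √(1 − x²) q; equivalently p = x + √(1 − x²) q, where √(1 − x²) is the positive square root of the positive element 1 − x² given by the continuous functional calculus. -/
/-- A selfadjoint element at distance at most `1` from the unit is nonnegative. -/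
theorem IsSelfAdjoint.nonneg_of_norm_one_sub_le {A : Type*} [CStarAlgebra A] [PartialOrder A]
    [StarOrderedRing A] {b : A} (hb : IsSelfAdjoint b) (h : ‖1 - b‖ ≤ 1) : 0 ≤ b := by
  have h1 : 1 - b ≤ algebraMap ℝ A ‖1 - b‖ :=
    IsSelfAdjoint.le_algebraMap_norm_self (IsSelfAdjoint.sub (.one A) hb)
  have h2 : algebraMap ℝ A ‖1 - b‖ ≤ algebraMap ℝ A 1 := algebraMap_mono A h
  rw [map_one] at h2
  exact sub_le_self_iff 1 |>.mp (h1.trans h2)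

/-- A selfadjoint square root of the unit has norm at most `1`. -/
theorem IsSelfAdjoint.norm_le_one_of_sq_eq_one {A : Type*} [CStarAlgebra A] {q : A}
    (hq : IsSelfAdjoint q) (hq2 : q ^ 2 = 1) : ‖q‖ ≤ 1 := by
  have hn : ‖q‖ * ‖q‖ = ‖(1 : A)‖ := by
    rw [← CStarRing.norm_star_mul_self, hq.star_eq, ← sq, hq2]
  rcases subsingleton_or_nontrivial A with _ | _
  · simp [Subsingleton.elim q 0]
  · rw [CStarRing.norm_one] at hn
    nlinarith [norm_nonneg q]

/-- In a unital C*-algebra, let `p, q` be selfadjoint with `p ^ 2 = q ^ 2 = 1`, and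
set `x := (p - q * p * q) / 2`, `y := (p + q * p * q) / 2`, so that `p = x + y`, `x` is selfadjoint
and anticommutes with `q`, and `y` is selfadjoint and commutes with `q`.  If `‖x‖ < √3 / 2` and
`‖y - q‖ < 1 / 2`, then `y = CFC.sqrt (1 - x ^ 2) * q`, i.e. `p = x + √(1 - x²) q`. -/
theorem stmt_2 {A : Type*} [CStarAlgebra A] [PartialOrder A] [StarOrderedRing A]
    (p q : A) (hp : IsSelfAdjoint p) (hq : IsSelfAdjoint q)
    (hp2 : p ^ 2 = 1) (hq2 : q ^ 2 = 1)
    (x y : A)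
    (hxdef : x = (2 : ℂ)⁻¹ • (p - q * p * q))
    (hydef : y = (2 : ℂ)⁻¹ • (p + q * p * q))
    (hxn : ‖x‖ < Real.sqrt 3 / 2) (hyn : ‖y - q‖ < 1 / 2) :
    p = x + y ∧ IsSelfAdjoint x ∧ x * q = -(q * x) ∧
      IsSelfAdjoint y ∧ y * q = q * y ∧
      y = CFC.sqrt (1 - x ^ 2) * q := by
  have hqq : q * q = 1 := by rw [← sq, hq2]
  have hpp : p * p = 1 := by rw [← sq, hp2]
  have hqqc (a : A) : q * (q * a) = a := by rw [← mul_assoc, hqq, one_mul]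
  have hppc (a : A) : p * (p * a) = a := by rw [← mul_assoc, hpp, one_mul]
  have hqpq : IsSelfAdjoint (q * p * q) := by
    simp [IsSelfAdjoint, hq.star_eq, hp.star_eq, mul_assoc]
  have htwo : IsSelfAdjoint (2 : ℂ)⁻¹ := by simp [IsSelfAdjoint]
  have hx : IsSelfAdjoint x := hxdef ▸ htwo.smul (hp.sub hqpq)
  have hy : IsSelfAdjoint y := hydef ▸ htwo.smul (hp.add hqpq)
  have hcomm : y * q = q * y := by
    simp only [hydef, smul_mul_assoc, mul_smul_comm, add_mul, mul_add, mul_assoc, hqq, hqqc,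
      mul_one, add_comm]
  have hsq : (y * q) * (y * q) = 1 - x ^ 2 := by
    have hyy : (y * q) * (y * q) = y * y := by
      rw [mul_assoc, ← mul_assoc q, ← hcomm, mul_assoc y, hqq, mul_one]
    rw [hyy, eq_sub_iff_add_eq, sq, hxdef, hydef]
    simp only [smul_mul_assoc, mul_smul_comm, add_mul, mul_add, sub_mul, mul_sub, mul_assoc, hqq,
      hqqc, hpp, hppc]
    module
  have hyq : IsSelfAdjoint (y * q) := (hy.commute_iff hq).mp hcomm
  have hnonneg : 0 ≤ y * q := by
    refine hyq.nonneg_of_norm_one_sub_le ?_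
    calc ‖1 - y * q‖ = ‖(y - q) * q‖ := by rw [sub_mul, hqq, norm_sub_rev]
      _ ≤ ‖y - q‖ * ‖q‖ := norm_mul_le _ _
      _ ≤ ‖y - q‖ := mul_le_of_le_one_right (norm_nonneg _) (hq.norm_le_one_of_sq_eq_one hq2)
      _ ≤ 1 := by linarith
  refine ⟨?_, hx, ?_, hy, hcomm, ?_⟩
  · rw [hxdef, hydef]
    module
  · simp only [hxdef, smul_mul_assoc, mul_smul_comm, sub_mul, mul_sub, mul_assoc, hqq, hqqc,
      mul_one]
    module
  · rw [CFC.sqrt_unique hsq hnonneg, mul_assoc, hqq, mul_one]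
end

section
/- Let H be a complex Hilbert space and let A be a bounded selfadjoint operator on H such that A² − A is a compact operator. Then there exists a bounded selfadjoint operator E on H with E² = E (i.e. an orthogonal projection) such that A − E is compact. In other words, every symmetric idempotent element of the Calkin algebra of H is the image of an orthogonal projection of H under the quotient map. -/
open Module.End in
/-- A compact selfadjoint operator has only finitely many eigenvalues outside any ball around
zero. -/
theorem IsCompactOperator.finite_setOf_hasEigenvalue_of_le_norm {𝕜 H : Type*} [RCLike 𝕜]
    [NormedAddCommGroup H] [InnerProductSpace 𝕜 H] {T : H →L[𝕜] H}
    (hT : IsCompactOperator T) (hsymm : (T : H →ₗ[𝕜] H).IsSymmetric) {r : ℝ} (hr : 0 < r) :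
    {μ : 𝕜 | r ≤ ‖μ‖ ∧ HasEigenvalue (T : Module.End 𝕜 H) μ}.Finite := by
  by_contra hinf
  let μ := Set.Infinite.natEmbedding _ hinf
  have hμ (n : ℕ) : r ≤ ‖(μ n : 𝕜)‖ := (μ n).2.1
  have hvec (n : ℕ) : ∃ v : H, ‖v‖ = 1 ∧ T v = (μ n : 𝕜) • v := by
    obtain ⟨v, hv⟩ := (μ n).2.2.exists_hasEigenvector
    have hv0 : ‖v‖ ≠ 0 := norm_ne_zero_iff.mpr hv.2
    refine ⟨((‖v‖⁻¹ : ℝ) : 𝕜) • v, ?_, ?_⟩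
    · simp [norm_smul, hv0]
    · have hTv : T v = (μ n : 𝕜) • v := hv.apply_eq_smul
      rw [map_smul, hTv, smul_comm]
  choose e he hTe using hvec
  have horth {m n : ℕ} (hmn : m ≠ n) : inner 𝕜 (e m) (e n) = 0 := by
    have hne : (μ m : 𝕜) ≠ μ n := fun h ↦ hmn (μ.injective (Subtype.ext h))
    exact hsymm.orthogonalFamily_eigenspaces hne
      ⟨e m, mem_eigenspace_iff.mpr (hTe m)⟩ ⟨e n, mem_eigenspace_iff.mpr (hTe n)⟩
  have hfar {m n : ℕ} (hmn : m ≠ n) : r ≤ ‖T (e m) - T (e n)‖ := by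
    have hsq : ‖T (e m) - T (e n)‖ * ‖T (e m) - T (e n)‖ =
        ‖(μ m : 𝕜)‖ * ‖(μ m : 𝕜)‖ + ‖(μ n : 𝕜)‖ * ‖(μ n : 𝕜)‖ := by
      rw [hTe, hTe, sub_eq_add_neg, norm_add_sq_eq_norm_sq_add_norm_sq_of_inner_eq_zero
        (𝕜 := 𝕜)]
      · simp [norm_smul, he]
      · simp [inner_smul_left, inner_smul_right, horth hmn]
    nlinarith [hμ m, hμ n, norm_nonneg (T (e m) - T (e n))]
  obtain ⟨C, hC, hTC⟩ := hT.image_closedBall_subset_compact 1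
  obtain ⟨y, -, φ, hφ, hφy⟩ := hC.tendsto_subseq fun n ↦ hTC ⟨e n, by simp [he], rfl⟩
  obtain ⟨N, hN⟩ := Metric.cauchySeq_iff'.mp hφy.cauchySeq r hr
  have hlt : ‖T (e (φ (N + 1))) - T (e (φ N))‖ < r := by
    simpa [dist_eq_norm_sub] using hN (N + 1) N.le_succ
  exact hlt.not_ge (hfar (hφ N.lt_succ_self).ne')

/-- If `A` is selfadjoint and `A ^ 2 - A` is compact, then the spectrum of `A` has a gap in the
unit interval. -/
theorem IsSelfAdjoint.exists_notMem_spectrum_of_isCompactOperator {H : Type*}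
    [NormedAddCommGroup H] [InnerProductSpace ℂ H] [CompleteSpace H] {A : H →L[ℂ] H}
    (hA : IsSelfAdjoint A) (hcpt : IsCompactOperator ⇑(A ^ 2 - A)) :
    ∃ t ∈ Set.Ioo (0 : ℝ) 1, t ∉ spectrum ℝ A := by
  by_contra! hspec
  have hK : cfc (fun x : ℝ ↦ x ^ 2 - x) A = A ^ 2 - A := by
    rw [cfc_sub (fun x : ℝ ↦ x ^ 2) (fun x ↦ x) A, cfc_pow_id A 2, cfc_id' ℝ A]
  have hsa : IsSelfAdjoint (A ^ 2 - A) := (hA.pow 2).sub hA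
  have hinj : Set.InjOn (fun t : ℝ ↦ ((t ^ 2 - t : ℝ) : ℂ)) (Set.Ioo (1 / 4) (1 / 2)) := by
    intro s hs t ht hst
    have hst' : s ^ 2 - s = t ^ 2 - t := Complex.ofReal_injective hst
    have hprod : (s - t) * (s + t - 1) = 0 := by linarith
    rcases mul_eq_zero.mp hprod with h | h
    · linarith
    · linarith [hs.2, ht.2]
  have hinf := (Set.Ioo_infinite (show (1 / 4 : ℝ) < 1 / 2 by norm_num)).image hinj
  refine hinf ((hcpt.finite_setOf_hasEigenvalue_of_le_norm hsa.isSymmetric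
    (show (0 : ℝ) < 3 / 16 by norm_num)).subset ?_)
  rintro _ ⟨t, ht, rfl⟩
  have hnorm : 3 / 16 ≤ ‖((t ^ 2 - t : ℝ) : ℂ)‖ := by
    rw [Complex.norm_real, Real.norm_eq_abs, abs_of_neg] <;> nlinarith [ht.1, ht.2]
  refine ⟨hnorm, ?_⟩
  rw [hcpt.hasEigenvalue_iff_mem_spectrum (norm_pos_iff.mp (by linarith))]
  have hmem : t ^ 2 - t ∈ spectrum ℝ (A ^ 2 - A) := by
    rw [← hK, cfc_map_spectrum (fun x : ℝ ↦ x ^ 2 - x) A]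
    exact ⟨t, hspec t ⟨by linarith [ht.1], by linarith [ht.2]⟩, rfl⟩
  exact spectrum.algebraMap_mem ℂ hmem

/-- A function which is continuous on both sides of `t` is continuous on any set avoiding `t`
after gluing. -/
theorem ContinuousOn.ite_lt_of_notMem {α β : Type*} [TopologicalSpace α] [LinearOrder α]
    [OrderClosedTopology α] [TopologicalSpace β] {f g : α → β} {s : Set α} {t : α}
    (ht : t ∉ s) (hf : ContinuousOn f (s ∩ Set.Ioi t)) (hg : ContinuousOn g (s ∩ Set.Iio t)) :
    ContinuousOn (fun x ↦ if t < x then f x else g x) s := by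
  intro x hx
  rcases lt_or_gt_of_ne (ne_of_mem_of_not_mem hx ht) with hxt | hxt
  · have hnhds := Iio_mem_nhds hxt
    refine ((continuousWithinAt_inter hnhds).mp (hg x ⟨hx, hxt⟩)).congr_of_eventuallyEq ?_
      (if_neg hxt.not_gt)
    filter_upwards [mem_nhdsWithin_of_mem_nhds hnhds] with y hy
    exact if_neg (not_lt_of_gt hy)
  · have hnhds := Ioi_mem_nhds hxt
    refine ((continuousWithinAt_inter hnhds).mp (hf x ⟨hx, hxt⟩)).congr_of_eventuallyEq ?_
      (if_pos hxt)
    filter_upwards [mem_nhdsWithin_of_mem_nhds hnhds] with y hy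
    exact if_pos hy

/-- If `A` is a bounded selfadjoint operator on a complex Hilbert space `H` such that
`A ^ 2 - A` is compact, then there is an orthogonal projection `E` (a bounded selfadjoint
idempotent) with `A - E` compact: every symmetric idempotent of the Calkin algebra lifts to an
orthogonal projection. -/
theorem stmt_6 {H : Type*} [NormedAddCommGroup H] [InnerProductSpace ℂ H] [CompleteSpace H]
    (A : H →L[ℂ] H) (hA : IsSelfAdjoint A)
    (hcpt : IsCompactOperator ⇑(A ^ 2 - A)) :
    ∃ E : H →L[ℂ] H, IsSelfAdjoint E ∧ E ^ 2 = E ∧ IsCompactOperator ⇑(A - E) := by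
  obtain ⟨t, ⟨ht0, ht1⟩, ht⟩ := hA.exists_notMem_spectrum_of_isCompactOperator hcpt
  let p : ℝ → ℝ := fun x ↦ if t < x then 1 else 0
  let g : ℝ → ℝ := fun x ↦ if t < x then x⁻¹ else (x - 1)⁻¹
  have hp : ContinuousOn p (spectrum ℝ A) :=
    ContinuousOn.ite_lt_of_notMem ht continuousOn_const continuousOn_const
  have hg : ContinuousOn g (spectrum ℝ A) := by
    refine ContinuousOn.ite_lt_of_notMem ht (continuousOn_id.inv₀ ?_)
      ((continuousOn_id.sub continuousOn_const).inv₀ ?_)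
    · exact fun x hx ↦ (ht0.trans hx.2).ne'
    · exact fun x hx ↦ (sub_neg.mpr (lt_trans hx.2 ht1)).ne
  have hK : cfc (fun x : ℝ ↦ x ^ 2 - x) A = A ^ 2 - A := by
    rw [cfc_sub (fun x : ℝ ↦ x ^ 2) (fun x ↦ x) A, cfc_pow_id A 2, cfc_id' ℝ A]
  refine ⟨cfc p A, cfc_predicate p A, ?_, ?_⟩
  · rw [← cfc_pow p 2 A hp]
    congr 1
    ext x
    by_cases hx : t < x <;> simp [p, hx]
  · have hfactor : A - cfc p A = cfc g A * (A ^ 2 - A) := by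
      rw [← hK, ← cfc_mul g _ A hg]
      nth_rw 1 [← cfc_id' ℝ A]
      rw [← cfc_sub (fun x : ℝ ↦ x) p A (by fun_prop) hp]
      refine cfc_congr fun x hx ↦ ?_
      have hxt : x ≠ t := ne_of_mem_of_not_mem hx ht
      rcases lt_or_gt_of_ne hxt with h | h
      · have hx1 : x - 1 ≠ 0 := by linarith
        simp only [p, g, if_neg h.not_gt]
        field_simp
        ring
      · have hx0 : x ≠ 0 := by linarith
        simp only [p, g, if_pos h]
        field_simp
    rw [hfactor]
    exact hcpt.clm_comp (cfc g A)
end
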